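/- Let (A, F, μ, η, Δ, ε, τ_{F,F}, Φ) be a quasi-bimonad in a 2-category K such that τ_{F,Id_A} is natural with respect to Φ. Then the category of left Tambara modules over (A,F,Φ) is a (non-strict) monoidal category: the unit object is (Id_A, id_F) with trivial F-action, the tensor product of (X, τ_{F,X}) and (Y, τ_{F,Y}) is (X∘Y, τ_{F,XY}) with the diagonal F-action through Δ and τ_{F,X}, the unit constraints are identities, and the associativity constraint α_{X,Y,Z} : (X∘Y)∘Z → X∘(Y∘Z) is given by acting with Φ : Id_A → F∘F∘F on the three factors via the distributive laws τ_{F,X}, τ_{F,Y} and the three module actions. -/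

import Mathlib

open CategoryTheory Bicategory

namespace Paper

variable {K : Type*} [Bicategory K]

/-- A monad in a bicategory. -/
structure Mnd (a : K) where
  E : a ⟶ a
  mul : E ≫ E ⟶ E
  unit : 𝟙 a ⟶ E
  assoc : (α_ E E E).inv ≫ mul ▷ E ≫ mul = E ◁ mul ≫ mul
  left_unit : (λ_ E).inv ≫ unit ▷ E ≫ mul = 𝟙 E
  right_unit : (ρ_ E).inv ≫ E ◁ unit ≫ mul = 𝟙 E

variable {a : K}

/-- Tensor (= horizontal composite) of two "unit elements". -/
def tunit {X Y : a ⟶ a} (u : 𝟙 a ⟶ X) (v : 𝟙 a ⟶ Y) : 𝟙 a ⟶ X ≫ Y :=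
  (λ_ (𝟙 a)).inv ≫ u ▷ 𝟙 a ≫ X ◁ v

/-- Multiplication on a composite `X ≫ Y` built from multiplications on `X`, `Y`
and a distributive law `d : Y ≫ X ⟶ X ≫ Y`. -/
def tmul {X Y : a ⟶ a} (mX : X ≫ X ⟶ X) (mY : Y ≫ Y ⟶ Y) (d : Y ≫ X ⟶ X ≫ Y) :
    (X ≫ Y) ≫ X ≫ Y ⟶ X ≫ Y :=
  (α_ X Y (X ≫ Y)).hom ≫ X ◁ ((α_ Y X Y).inv ≫ d ▷ Y ≫ (α_ X Y Y).hom) ≫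
    (α_ X X (Y ≫ Y)).inv ≫ mX ▷ (Y ≫ Y) ≫ X ◁ mY

/-- Comultiplication on a composite `X ≫ Y`. -/
def tcomul {X Y : a ⟶ a} (cX : X ⟶ X ≫ X) (cY : Y ⟶ Y ≫ Y) (d : X ≫ Y ⟶ Y ≫ X) :
    X ≫ Y ⟶ (X ≫ Y) ≫ X ≫ Y :=
  cX ▷ Y ≫ (α_ X X Y).hom ≫
    X ◁ (X ◁ cY ≫ (α_ X Y Y).inv ≫ d ▷ Y ≫ (α_ Y X Y).hom) ≫ (α_ X Y (X ≫ Y)).inv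

/-- Extend distributive laws, moving `X` to the left across a composite `Y1 ≫ Y2`. -/
def dext {X Y1 Y2 : a ⟶ a} (d1 : Y1 ≫ X ⟶ X ≫ Y1) (d2 : Y2 ≫ X ⟶ X ≫ Y2) :
    (Y1 ≫ Y2) ≫ X ⟶ X ≫ Y1 ≫ Y2 :=
  (α_ Y1 Y2 X).hom ≫ Y1 ◁ d2 ≫ (α_ Y1 X Y2).inv ≫ d1 ▷ Y2 ≫ (α_ X Y1 Y2).hom

/-- Extend distributive laws, moving `X` to the right across a composite `Y1 ≫ Y2`. -/
def dext' {X Y1 Y2 : a ⟶ a} (d1 : X ≫ Y1 ⟶ Y1 ≫ X) (d2 : X ≫ Y2 ⟶ Y2 ≫ X) :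
    X ≫ Y1 ≫ Y2 ⟶ (Y1 ≫ Y2) ≫ X :=
  (α_ X Y1 Y2).inv ≫ d1 ▷ Y2 ≫ (α_ Y1 X Y2).hom ≫ Y1 ◁ d2 ≫ (α_ Y1 Y2 X).inv

/-- Convolution product of `f g : 𝟙 a ⟶ T` with respect to a multiplication on `T`. -/
def conv {T : a ⟶ a} (m : T ≫ T ⟶ T) (f g : 𝟙 a ⟶ T) : 𝟙 a ⟶ T :=
  (λ_ (𝟙 a)).inv ≫ f ▷ 𝟙 a ≫ T ◁ g ≫ m

/-- Convolution product of `f g : T ⟶ 𝟙 a` with respect to a comultiplication on `T`. -/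
def convC {T : a ⟶ a} (c : T ⟶ T ≫ T) (f g : T ⟶ 𝟙 a) : T ⟶ 𝟙 a :=
  c ≫ f ▷ T ≫ (λ_ T).hom ≫ g

/-- The multiplication on `E ≫ E ≫ E` built from `mul` and the distributive law `τ`. -/
def mul3 {E : a ⟶ a} (mul : E ≫ E ⟶ E) (τ : E ≫ E ⟶ E ≫ E) :
    (E ≫ E ≫ E) ≫ E ≫ E ≫ E ⟶ E ≫ E ≫ E :=
  tmul mul (tmul mul mul τ) (dext τ τ)

/-- The multiplication on `E ≫ E ≫ E ≫ E`. -/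
def mul4 {E : a ⟶ a} (mul : E ≫ E ⟶ E) (τ : E ≫ E ⟶ E ≫ E) :
    (E ≫ E ≫ E ≫ E) ≫ E ≫ E ≫ E ≫ E ⟶ E ≫ E ≫ E ≫ E :=
  tmul mul (mul3 mul τ) (dext τ (dext τ τ))

/-- The comultiplication on `E ≫ E ≫ E`. -/
def comul3 {E : a ⟶ a} (comul : E ⟶ E ≫ E) (τ : E ≫ E ⟶ E ≫ E) :
    E ≫ E ≫ E ⟶ (E ≫ E ≫ E) ≫ E ≫ E ≫ E :=
  tcomul comul (tcomul comul comul τ) (dext' τ τ)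

/-- The comultiplication on `E ≫ E ≫ E ≫ E`. -/
def comul4 {E : a ⟶ a} (comul : E ⟶ E ≫ E) (τ : E ≫ E ⟶ E ≫ E) :
    E ≫ E ≫ E ≫ E ⟶ (E ≫ E ≫ E ≫ E) ≫ E ≫ E ≫ E ≫ E :=
  tcomul comul (comul3 comul τ) (dext' τ (dext' τ τ))

/-- "Action of `Q ≫ P` on `X ≫ Y`": `P` crosses `X` via `dPX`, then `Q` acts on `X`
and `P` acts on `Y`. -/
def actT {b : K} {P Q X : a ⟶ a} {Y : a ⟶ b}
    (dPX : P ≫ X ⟶ X ≫ P) (aQX : Q ≫ X ⟶ X) (aPY : P ≫ Y ⟶ Y) :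
    (Q ≫ P) ≫ X ≫ Y ⟶ X ≫ Y :=
  (α_ Q P (X ≫ Y)).hom ≫ Q ◁ ((α_ P X Y).inv ≫ dPX ▷ Y ≫ (α_ X P Y).hom) ≫
    (α_ Q X (P ≫ Y)).inv ≫ aQX ▷ (P ≫ Y) ≫ X ◁ aPY

/-- A quasi-bimonad `(A, F, μ, η, Δ, ε, τ_{F,F}, Φ)` in a 2-category, together with
the condition that `τ_{F,Id_A}` is natural with respect to `Φ`. -/
structure QuasiBimonad (a : K) extends Mnd a where
  comul : E ⟶ E ≫ E
  counit : E ⟶ 𝟙 a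
  τ : E ≫ E ⟶ E ≫ E
  /-- `τ` is a left monadic distributive law -/
  τ_lm : E ◁ τ ≫ (α_ E E E).inv ≫ τ ▷ E ≫ (α_ E E E).hom ≫ E ◁ mul
      = (α_ E E E).inv ≫ mul ▷ E ≫ τ
  τ_lm_unit : (λ_ E).inv ≫ unit ▷ E ≫ τ = (ρ_ E).inv ≫ E ◁ unit
  /-- `τ` is a right monadic distributive law -/
  τ_rm : τ ▷ E ≫ (α_ E E E).hom ≫ E ◁ τ ≫ (α_ E E E).inv ≫ mul ▷ E
      = (α_ E E E).hom ≫ E ◁ mul ≫ τ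
  τ_rm_unit : (ρ_ E).inv ≫ E ◁ unit ≫ τ = (λ_ E).inv ≫ unit ▷ E
  /-- `τ` is a left comonadic distributive law -/
  τ_lc : comul ▷ E ≫ (α_ E E E).hom ≫ E ◁ τ ≫ (α_ E E E).inv ≫ τ ▷ E ≫ (α_ E E E).hom
      = τ ≫ E ◁ comul
  τ_lc_counit : τ ≫ counit ▷ E ≫ (λ_ E).hom = E ◁ counit ≫ (ρ_ E).hom
  /-- `τ` is a right comonadic distributive law -/
  τ_rc : E ◁ comul ≫ (α_ E E E).inv ≫ τ ▷ E ≫ (α_ E E E).hom ≫ E ◁ τ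
      = τ ≫ comul ▷ E ≫ (α_ E E E).hom
  τ_rc_counit : τ ≫ E ◁ counit ≫ (ρ_ E).hom = counit ▷ E ≫ (λ_ E).hom
  /-- counitality of the comultiplication -/
  counit_comul : comul ≫ counit ▷ E ≫ (λ_ E).hom = 𝟙 E
  comul_counit : comul ≫ E ◁ counit ≫ (ρ_ E).hom = 𝟙 E
  /-- bialgebra-type compatibility of `mul` and `comul` through `τ` -/
  mul_comul : mul ≫ comul = comul ▷ E ≫ (E ≫ E) ◁ comul ≫ tmul mul mul τ
  comul_unit : unit ≫ comul = tunit unit unit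
  counit_mul : mul ≫ counit = E ◁ counit ≫ (ρ_ E).hom ≫ counit
  counit_unit : unit ≫ counit = 𝟙 (𝟙 a)
  /-- the reassociator `Φ` -/
  Φ : 𝟙 a ⟶ E ≫ E ≫ E
  /-- `Φ` is normalized -/
  Φ_normal : Φ ≫ E ◁ (counit ▷ E) ≫ E ◁ (λ_ E).hom = tunit unit unit
  /-- `Φ` is convolution invertible -/
  Φ_inv : ∃ Φ' : 𝟙 a ⟶ E ≫ E ≫ E,
      conv (mul3 mul τ) Φ Φ' = tunit unit (tunit unit unit) ∧
      conv (mul3 mul τ) Φ' Φ = tunit unit (tunit unit unit)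
  /-- quasi-coassociativity -/
  quasi_coassoc :
      comul ≫ comul ▷ E ≫ (α_ E E E).hom ≫ (λ_ (E ≫ E ≫ E)).inv ≫
        Φ ▷ (E ≫ E ≫ E) ≫ mul3 mul τ
      = comul ≫ E ◁ comul ≫ (ρ_ (E ≫ E ≫ E)).inv ≫ (E ≫ E ≫ E) ◁ Φ ≫ mul3 mul τ
  /-- the 3-cocycle condition for `Φ` -/
  cocycle :
      conv (mul4 mul τ)
        (conv (mul4 mul τ) (tunit unit Φ)
          (Φ ≫ E ◁ (comul ▷ E) ≫ E ◁ (α_ E E E).hom))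
        (tunit Φ unit ≫ (α_ E (E ≫ E) E).hom ≫ E ◁ (α_ E E E).hom)
      = conv (mul4 mul τ) (Φ ≫ E ◁ (E ◁ comul))
          (Φ ≫ comul ▷ (E ≫ E) ≫ (α_ E E (E ≫ E)).hom)
  /-- `τ_{F,Id_A}` is natural with respect to `Φ` -/
  Φ_nat : (λ_ E).inv ≫ Φ ▷ E = (ρ_ E).inv ≫ E ◁ Φ ≫ dext' τ (dext' τ τ)

/-- The data of a left Tambara module over a quasi-bimonad. -/
structure QBModData (Q : QuasiBimonad a) where
  X : a ⟶ a
  d : Q.E ≫ X ⟶ X ≫ Q.E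
  act : Q.E ≫ X ⟶ X

/-- The axioms of a left Tambara module over a quasi-bimonad `(A, F, Φ)`:
`(X, τ_{F,X})` is an object of `QB(K)(F)` (monadic and comonadic distributive law,
naturality with respect to `Φ`, Yang–Baxter equation with `τ_{F,F}`), `X` is a left
`F`-module, and the action is a morphism in `QB(K)(F)`. -/
def IsQBMod (Q : QuasiBimonad a) (M : QBModData Q) : Prop :=
  (Q.E ◁ M.d ≫ (α_ Q.E M.X Q.E).inv ≫ M.d ▷ Q.E ≫ (α_ M.X Q.E Q.E).hom ≫ M.X ◁ Q.mul
      = (α_ Q.E Q.E M.X).inv ≫ Q.mul ▷ M.X ≫ M.d) ∧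
  ((λ_ M.X).inv ≫ Q.unit ▷ M.X ≫ M.d = (ρ_ M.X).inv ≫ M.X ◁ Q.unit) ∧
  (Q.comul ▷ M.X ≫ (α_ Q.E Q.E M.X).hom ≫ Q.E ◁ M.d ≫ (α_ Q.E M.X Q.E).inv ≫
      M.d ▷ Q.E ≫ (α_ M.X Q.E Q.E).hom = M.d ≫ M.X ◁ Q.comul) ∧
  (M.d ≫ M.X ◁ Q.counit ≫ (ρ_ M.X).hom = Q.counit ▷ M.X ≫ (λ_ M.X).hom) ∧
  ((ρ_ M.X).inv ≫ M.X ◁ Q.Φ = (λ_ M.X).inv ≫ Q.Φ ▷ M.X ≫ dext M.d (dext M.d M.d)) ∧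
  (Q.E ◁ M.d ≫ (α_ Q.E M.X Q.E).inv ≫ M.d ▷ Q.E ≫ (α_ M.X Q.E Q.E).hom ≫ M.X ◁ Q.τ
      = (α_ Q.E Q.E M.X).inv ≫ Q.τ ▷ M.X ≫ (α_ Q.E Q.E M.X).hom ≫ Q.E ◁ M.d ≫
        (α_ Q.E M.X Q.E).inv ≫ M.d ▷ Q.E ≫ (α_ M.X Q.E Q.E).hom) ∧
  ((α_ Q.E Q.E M.X).inv ≫ Q.mul ▷ M.X ≫ M.act = Q.E ◁ M.act ≫ M.act) ∧
  ((λ_ M.X).inv ≫ Q.unit ▷ M.X ≫ M.act = 𝟙 M.X) ∧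
  (Q.E ◁ M.act ≫ M.d
      = (α_ Q.E Q.E M.X).inv ≫ Q.τ ▷ M.X ≫ (α_ Q.E Q.E M.X).hom ≫ Q.E ◁ M.d ≫
        (α_ Q.E M.X Q.E).inv ≫ M.act ▷ Q.E)

/-- Morphisms of Tambara modules: left `F`-linear 2-cells compatible with the
distributive laws. -/
def IsQBHom (Q : QuasiBimonad a) (M N : QBModData Q) (f : M.X ⟶ N.X) : Prop :=
  (M.act ≫ f = Q.E ◁ f ≫ N.act) ∧ (M.d ≫ f ▷ Q.E = Q.E ◁ f ≫ N.d)

/-- The tensor product of two Tambara modules: the composite 1-cell with the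
composite distributive law and the diagonal action through `Δ`. -/
def qbTensor (Q : QuasiBimonad a) (M N : QBModData Q) : QBModData Q where
  X := M.X ≫ N.X
  d := dext' M.d N.d
  act := Q.comul ▷ (M.X ≫ N.X) ≫ actT M.d M.act N.act

/-- The unit object `(Id_A, id_F)` with the trivial `F`-action. -/
def qbUnit (Q : QuasiBimonad a) : QBModData Q where
  X := 𝟙 a
  d := (ρ_ Q.E).hom ≫ (λ_ Q.E).inv
  act := (ρ_ Q.E).hom ≫ Q.counit

/-- The associativity constraint of the category of Tambara modules, given by the
action of `Φ`. -/
def qbAssoc (Q : QuasiBimonad a) (M N P : QBModData Q) :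
    (M.X ≫ N.X) ≫ P.X ⟶ M.X ≫ N.X ≫ P.X :=
  (α_ M.X N.X P.X).hom ≫ (λ_ (M.X ≫ N.X ≫ P.X)).inv ≫ Q.Φ ▷ (M.X ≫ N.X ≫ P.X) ≫
    actT (dext M.d M.d) M.act (actT N.d N.act P.act)


/-! ### Distributive laws and actions -/

/-- `act` is an associative action of `(T, m)` on `Y`. -/
def IsAct {T Y : a ⟶ a} (m : T ≫ T ⟶ T) (act : T ≫ Y ⟶ Y) : Prop :=
  (α_ T T Y).inv ≫ m ▷ Y ≫ act = T ◁ act ≫ act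

/-- The law `d` is compatible with the multiplication `m` of the moving 1-cell. -/
def MulCompat {P X : a ⟶ a} (m : P ≫ P ⟶ P) (d : P ≫ X ⟶ X ≫ P) : Prop :=
  P ◁ d ≫ (α_ P X P).inv ≫ d ▷ P ≫ (α_ X P P).hom ≫ X ◁ m = (α_ P P X).inv ≫ m ▷ X ≫ d

/-- The Yang–Baxter equation. -/
def YangBaxter {P Q X : a ⟶ a} (t : P ≫ Q ⟶ Q ≫ P) (dP : P ≫ X ⟶ X ≫ P)
    (dQ : Q ≫ X ⟶ X ≫ Q) : Prop :=
  P ◁ dQ ≫ (α_ P X Q).inv ≫ dP ▷ Q ≫ (α_ X P Q).hom ≫ X ◁ t =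
    (α_ P Q X).inv ≫ t ▷ X ≫ (α_ Q P X).hom ≫ Q ◁ dP ≫ (α_ Q X P).inv ≫ dQ ▷ P ≫
      (α_ X Q P).hom

/-- The action `aQ` of `Q` on `X` is compatible with moving `P` across. -/
def ActCompat {P Q X : a ⟶ a} (t : P ≫ Q ⟶ Q ≫ P) (dP : P ≫ X ⟶ X ≫ P)
    (aQ : Q ≫ X ⟶ X) : Prop :=
  P ◁ aQ ≫ dP = (α_ P Q X).inv ≫ t ▷ X ≫ (α_ Q P X).hom ≫ Q ◁ dP ≫ (α_ Q X P).inv ≫ aQ ▷ P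

/-- The element `u` of `P` is natural with respect to the law `d`. -/
def NatElt {P X : a ⟶ a} (u : 𝟙 a ⟶ P) (d : P ≫ X ⟶ X ≫ P) : Prop :=
  (ρ_ X).inv ≫ X ◁ u = (λ_ X).inv ≫ u ▷ X ≫ d

/-- The 2-cell `p` is natural with respect to the laws `d` and `d'`. -/
def NatCell {P P' X : a ⟶ a} (p : P ⟶ P') (d : P ≫ X ⟶ X ≫ P) (d' : P' ≫ X ⟶ X ≫ P') : Prop :=
  p ▷ X ≫ d' = d ≫ X ◁ p

/-- The endomorphism of `Y` given by acting with an element of `T`. -/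
def eltAct {T Y : a ⟶ a} (u : 𝟙 a ⟶ T) (act : T ≫ Y ⟶ Y) : Y ⟶ Y :=
  (λ_ Y).inv ≫ u ▷ Y ≫ act

section Laws

variable {P P' P₁ P₂ P₃ Q Q' S S₁ S₂ T X X' Y Y' Z : a ⟶ a}

theorem dext_dext' (d₁ : S₁ ≫ X ⟶ X ≫ S₁) (e₁ : S₁ ≫ Y ⟶ Y ≫ S₁)
    (d₂ : S₂ ≫ X ⟶ X ≫ S₂) (e₂ : S₂ ≫ Y ⟶ Y ≫ S₂) :
    dext (dext' d₁ e₁) (dext' d₂ e₂) = dext' (dext d₁ d₂) (dext e₁ e₂) := by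
  calc
    _ = 𝟙 _ ⊗≫ S₁ ◁ d₂ ▷ Y ⊗≫ ((S₁ ≫ X) ◁ e₂ ≫ d₁ ▷ (Y ≫ S₂)) ⊗≫ X ◁ e₁ ▷ S₂ ⊗≫ 𝟙 _ := by
      dsimp only [dext, dext']; bicategory
    _ = _ := by
      rw [whisker_exchange]; dsimp only [dext, dext']; bicategory

theorem dext_assoc (d₁ : P₁ ≫ X ⟶ X ≫ P₁) (d₂ : P₂ ≫ X ⟶ X ≫ P₂) (d₃ : P₃ ≫ X ⟶ X ≫ P₃) :
    (α_ P₁ P₂ P₃).hom ▷ X ≫ dext d₁ (dext d₂ d₃) =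
      dext (dext d₁ d₂) d₃ ≫ X ◁ (α_ P₁ P₂ P₃).hom := by
  dsimp only [dext]; bicategory

theorem dext'_assoc (d₁ : P ≫ X ⟶ X ≫ P) (d₂ : P ≫ Y ⟶ Y ≫ P) (d₃ : P ≫ Z ⟶ Z ≫ P) :
    P ◁ (α_ X Y Z).hom ≫ dext' d₁ (dext' d₂ d₃) =
      dext' (dext' d₁ d₂) d₃ ≫ (α_ X Y Z).hom ▷ P := by
  dsimp only [dext']; bicategory

theorem actT_assoc (dPX : P ≫ X ⟶ X ≫ P) (dSX : S ≫ X ⟶ X ≫ S) (dSY : S ≫ Y ⟶ Y ≫ S)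
    (aQX : Q ≫ X ⟶ X) (aPY : P ≫ Y ⟶ Y) (aSZ : S ≫ Z ⟶ Z) :
    actT (dext' dSX dSY) (actT dPX aQX aPY) aSZ ≫ (α_ X Y Z).hom =
      (α_ Q P S).hom ▷ ((X ≫ Y) ≫ Z) ≫ (Q ≫ P ≫ S) ◁ (α_ X Y Z).hom ≫
        actT (dext dPX dSX) aQX (actT dSY aPY aSZ) := by
  symm
  calc
    _ = 𝟙 _ ⊗≫ Q ◁ P ◁ dSX ▷ Y ▷ Z ⊗≫ Q ◁ dPX ▷ S ▷ Y ▷ Z ⊗≫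
        (aQX ▷ (P ≫ (S ≫ Y) ≫ Z) ≫ X ◁ (P ◁ dSY ▷ Z)) ⊗≫ X ◁ aPY ▷ S ▷ Z ⊗≫ X ◁ Y ◁ aSZ ⊗≫
          𝟙 _ := by
      dsimp only [actT, dext]; bicategory
    _ = 𝟙 _ ⊗≫ Q ◁ P ◁ dSX ▷ Y ▷ Z ⊗≫ Q ◁ (dPX ▷ (S ≫ Y) ≫ (X ≫ P) ◁ dSY) ▷ Z ⊗≫
        aQX ▷ P ▷ Y ▷ S ▷ Z ⊗≫ X ◁ aPY ▷ S ▷ Z ⊗≫ X ◁ Y ◁ aSZ ⊗≫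
          𝟙 _ := by
      rw [← whisker_exchange]; bicategory
    _ = _ := by
      rw [← whisker_exchange]; dsimp only [actT, dext']; bicategory

theorem IsAct.actT {t : P ≫ Q ⟶ Q ≫ P} {mP : P ≫ P ⟶ P} {mQ : Q ≫ Q ⟶ Q}
    {dP : P ≫ X ⟶ X ≫ P} {aQ : Q ≫ X ⟶ X} {aP : P ≫ Y ⟶ Y}
    (hQ : IsAct mQ aQ) (hP : IsAct mP aP) (hm : MulCompat mP dP) (ht : ActCompat t dP aQ) :
    IsAct (tmul mQ mP t) (actT dP aQ aP) := by
  unfold IsAct MulCompat ActCompat at *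
  calc
    _ = 𝟙 _ ⊗≫ Q ◁ t ▷ P ▷ X ▷ Y ⊗≫ mQ ▷ P ▷ P ▷ X ▷ Y ⊗≫
        Q ◁ ((α_ P P X).inv ≫ mP ▷ X ≫ dP) ▷ Y ⊗≫ aQ ▷ P ▷ Y ⊗≫ X ◁ aP := by
      dsimp only [tmul, Paper.actT]; bicategory
    _ = 𝟙 _ ⊗≫ Q ◁ t ▷ P ▷ X ▷ Y ⊗≫
        (mQ ▷ (P ≫ P ≫ X ≫ Y) ≫ Q ◁ (𝟙 (P ≫ P ≫ X ≫ Y) ⊗≫ P ◁ dP ▷ Y ⊗≫ dP ▷ P ▷ Y)) ⊗≫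
          ((Q ≫ X) ◁ (mP ▷ Y) ≫ aQ ▷ (P ≫ Y)) ⊗≫ X ◁ aP := by
      rw [← hm]; bicategory
    _ = 𝟙 _ ⊗≫ Q ◁ (t ▷ ((P ≫ X) ≫ Y) ≫ (Q ≫ P) ◁ (dP ▷ Y)) ⊗≫ Q ◁ Q ◁ dP ▷ P ▷ Y ⊗≫
        mQ ▷ X ▷ P ▷ P ▷ Y ⊗≫
          aQ ▷ (P ≫ P) ▷ Y ⊗≫ X ◁ ((α_ P P Y).inv ≫ mP ▷ Y ≫ aP) := by
      rw [← whisker_exchange mQ, whisker_exchange aQ]; bicategory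
    _ = 𝟙 _ ⊗≫ Q ◁ P ◁ Q ◁ dP ▷ Y ⊗≫ Q ◁ t ▷ X ▷ P ▷ Y ⊗≫ Q ◁ Q ◁ dP ▷ P ▷ Y ⊗≫
        ((α_ Q Q X).inv ≫ mQ ▷ X ≫ aQ) ▷ P ▷ P ▷ Y ⊗≫ X ◁ ((α_ P P Y).inv ≫ mP ▷ Y ≫ aP) := by
      rw [← whisker_exchange t]; bicategory
    _ = 𝟙 _ ⊗≫ Q ◁ P ◁ Q ◁ dP ▷ Y ⊗≫
        Q ◁ ((α_ P Q X).inv ≫ t ▷ X ≫ (α_ Q P X).hom ≫ Q ◁ dP ≫ (α_ Q X P).inv ≫ aQ ▷ P) ▷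
          P ▷ Y ⊗≫ (aQ ▷ (P ≫ P ≫ Y) ≫ X ◁ (P ◁ aP)) ⊗≫ X ◁ aP := by
      rw [hQ, hP]; bicategory
    _ = 𝟙 _ ⊗≫ Q ◁ P ◁ Q ◁ dP ▷ Y ⊗≫ Q ◁ P ◁ aQ ▷ P ▷ Y ⊗≫
        Q ◁ (dP ▷ (P ≫ Y) ≫ (X ≫ P) ◁ aP) ⊗≫ aQ ▷ P ▷ Y ⊗≫ X ◁ aP := by
      rw [← ht, ← whisker_exchange aQ]; bicategory
    _ = _ := by
      rw [← whisker_exchange dP]; dsimp only [Paper.actT]; bicategory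

theorem MulCompat.dext {t : P ≫ Q ⟶ Q ≫ P} {mP : P ≫ P ⟶ P} {mQ : Q ≫ Q ⟶ Q}
    {dP : P ≫ X ⟶ X ≫ P} {dQ : Q ≫ X ⟶ X ≫ Q} (hQ : MulCompat mQ dQ) (hP : MulCompat mP dP)
    (hY : YangBaxter t dP dQ) : MulCompat (tmul mQ mP t) (dext dQ dP) := by
  unfold MulCompat YangBaxter at *
  calc
    _ = 𝟙 _ ⊗≫ Q ◁ P ◁ Q ◁ dP ⊗≫ Q ◁ P ◁ dQ ▷ P ⊗≫ Q ◁ dP ▷ Q ▷ P ⊗≫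
        (dQ ▷ (P ≫ Q) ≫ (X ≫ Q) ◁ t) ▷ P ⊗≫ X ◁ mQ ▷ P ▷ P ⊗≫ X ◁ Q ◁ mP ⊗≫ 𝟙 _ := by
      dsimp only [tmul, Paper.dext]; bicategory
    _ = 𝟙 _ ⊗≫ Q ◁ P ◁ Q ◁ dP ⊗≫
        Q ◁ (P ◁ dQ ≫ (α_ P X Q).inv ≫ dP ▷ Q ≫ (α_ X P Q).hom ≫ X ◁ t) ▷ P ⊗≫
          dQ ▷ Q ▷ P ▷ P ⊗≫ X ◁ mQ ▷ P ▷ P ⊗≫ X ◁ Q ◁ mP ⊗≫ 𝟙 _ := by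
      rw [← whisker_exchange]; bicategory
    _ = 𝟙 _ ⊗≫ Q ◁ ((P ≫ Q) ◁ dP ≫ t ▷ (X ≫ P)) ⊗≫ Q ◁ Q ◁ dP ▷ P ⊗≫
        (Q ◁ dQ ≫ (α_ Q X Q).inv ≫ dQ ▷ Q ≫ (α_ X Q Q).hom ≫ X ◁ mQ) ▷ P ▷ P ⊗≫
          X ◁ Q ◁ mP ⊗≫ 𝟙 _ := by
      rw [hY]; bicategory
    _ = 𝟙 _ ⊗≫ Q ◁ t ▷ P ▷ X ⊗≫ Q ◁ Q ◁ P ◁ dP ⊗≫ Q ◁ Q ◁ dP ▷ P ⊗≫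
        mQ ▷ X ▷ P ▷ P ⊗≫ (dQ ▷ (P ≫ P) ≫ (X ≫ Q) ◁ mP) ⊗≫ 𝟙 _ := by
      rw [hQ, whisker_exchange t]; bicategory
    _ = 𝟙 _ ⊗≫ Q ◁ t ▷ P ▷ X ⊗≫
        ((Q ≫ Q) ◁ (P ◁ dP ≫ (α_ P X P).inv ≫ dP ▷ P ≫ (α_ X P P).hom ≫ X ◁ mP) ≫
          mQ ▷ (X ≫ P)) ⊗≫ dQ ▷ P ⊗≫ 𝟙 _ := by
      rw [← whisker_exchange dQ]
      calc
        _ = 𝟙 _ ⊗≫ Q ◁ t ▷ P ▷ X ⊗≫ Q ◁ Q ◁ P ◁ dP ⊗≫ Q ◁ Q ◁ dP ▷ P ⊗≫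
            (mQ ▷ (X ≫ P ≫ P) ≫ Q ◁ (X ◁ mP)) ⊗≫ dQ ▷ P ⊗≫ 𝟙 _ := by bicategory
        _ = _ := by rw [← whisker_exchange mQ]; bicategory
    _ = _ := by
      rw [whisker_exchange, hP]; dsimp only [tmul, Paper.dext]; bicategory

theorem MulCompat.dext' {m : P ≫ P ⟶ P} {d₁ : P ≫ X ⟶ X ≫ P} {d₂ : P ≫ Y ⟶ Y ≫ P}
    (h₁ : MulCompat m d₁) (h₂ : MulCompat m d₂) : MulCompat m (dext' d₁ d₂) := by
  unfold MulCompat at *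
  calc
    _ = 𝟙 _ ⊗≫ P ◁ d₁ ▷ Y ⊗≫ ((P ≫ X) ◁ d₂ ≫ d₁ ▷ (Y ≫ P)) ⊗≫ X ◁ d₂ ▷ P ⊗≫
        X ◁ Y ◁ m ⊗≫ 𝟙 _ := by
      dsimp only [Paper.dext']; bicategory
    _ = 𝟙 _ ⊗≫ P ◁ d₁ ▷ Y ⊗≫ d₁ ▷ P ▷ Y ⊗≫
        X ◁ (P ◁ d₂ ≫ (α_ P Y P).inv ≫ d₂ ▷ P ≫ (α_ Y P P).hom ≫ Y ◁ m) ⊗≫ 𝟙 _ := by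
      rw [whisker_exchange]; bicategory
    _ = 𝟙 _ ⊗≫ (P ◁ d₁ ≫ (α_ P X P).inv ≫ d₁ ▷ P ≫ (α_ X P P).hom ≫ X ◁ m) ▷ Y ⊗≫
        X ◁ d₂ ⊗≫ 𝟙 _ := by
      rw [h₂]; bicategory
    _ = _ := by
      rw [h₁]; dsimp only [Paper.dext']; bicategory

theorem YangBaxter.dext_left {t₁ : P₁ ≫ Q ⟶ Q ≫ P₁} {t₂ : P₂ ≫ Q ⟶ Q ≫ P₂}
    {d₁ : P₁ ≫ X ⟶ X ≫ P₁} {d₂ : P₂ ≫ X ⟶ X ≫ P₂} {dQ : Q ≫ X ⟶ X ≫ Q}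
    (h₁ : YangBaxter t₁ d₁ dQ) (h₂ : YangBaxter t₂ d₂ dQ) :
    YangBaxter (dext t₁ t₂) (dext d₁ d₂) dQ := by
  unfold YangBaxter at *
  calc
    _ = 𝟙 _ ⊗≫ P₁ ◁ P₂ ◁ dQ ⊗≫ P₁ ◁ d₂ ▷ Q ⊗≫ (d₁ ▷ (P₂ ≫ Q) ≫ (X ≫ P₁) ◁ t₂) ⊗≫
        X ◁ t₁ ▷ P₂ ⊗≫ 𝟙 _ := by
      dsimp only [dext]; bicategory
    _ = 𝟙 _ ⊗≫ P₁ ◁ (P₂ ◁ dQ ≫ (α_ P₂ X Q).inv ≫ d₂ ▷ Q ≫ (α_ X P₂ Q).hom ≫ X ◁ t₂) ⊗≫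
        d₁ ▷ Q ▷ P₂ ⊗≫ X ◁ t₁ ▷ P₂ ⊗≫ 𝟙 _ := by
      rw [← whisker_exchange]; bicategory
    _ = 𝟙 _ ⊗≫ P₁ ◁ t₂ ▷ X ⊗≫ P₁ ◁ Q ◁ d₂ ⊗≫
        (P₁ ◁ dQ ≫ (α_ P₁ X Q).inv ≫ d₁ ▷ Q ≫ (α_ X P₁ Q).hom ≫ X ◁ t₁) ▷ P₂ ⊗≫ 𝟙 _ := by
      rw [h₂]; bicategory
    _ = 𝟙 _ ⊗≫ P₁ ◁ t₂ ▷ X ⊗≫ ((P₁ ≫ Q) ◁ d₂ ≫ t₁ ▷ (X ≫ P₂)) ⊗≫ Q ◁ d₁ ▷ P₂ ⊗≫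
        dQ ▷ P₁ ▷ P₂ ⊗≫ 𝟙 _ := by
      rw [h₁]; bicategory
    _ = _ := by
      rw [whisker_exchange]; dsimp only [dext]; bicategory

theorem YangBaxter.dext_right {t₁ : S ≫ P₁ ⟶ P₁ ≫ S} {t₂ : S ≫ P₂ ⟶ P₂ ≫ S}
    {d₁ : P₁ ≫ X ⟶ X ≫ P₁} {d₂ : P₂ ≫ X ⟶ X ≫ P₂} {dS : S ≫ X ⟶ X ≫ S}
    (h₁ : YangBaxter t₁ dS d₁) (h₂ : YangBaxter t₂ dS d₂) :
    YangBaxter (dext' t₁ t₂) dS (dext d₁ d₂) := by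
  unfold YangBaxter at *
  calc
    _ = 𝟙 _ ⊗≫ S ◁ P₁ ◁ d₂ ⊗≫
        (S ◁ d₁ ≫ (α_ S X P₁).inv ≫ dS ▷ P₁ ≫ (α_ X S P₁).hom ≫ X ◁ t₁) ▷ P₂ ⊗≫
          X ◁ P₁ ◁ t₂ ⊗≫ 𝟙 _ := by
      dsimp only [dext, dext']; bicategory
    _ = 𝟙 _ ⊗≫ ((S ≫ P₁) ◁ d₂ ≫ t₁ ▷ (X ≫ P₂)) ⊗≫ P₁ ◁ dS ▷ P₂ ⊗≫
          (d₁ ▷ (S ≫ P₂) ≫ (X ≫ P₁) ◁ t₂) ⊗≫ 𝟙 _ := by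
      rw [h₁]; bicategory
    _ = 𝟙 _ ⊗≫ t₁ ▷ P₂ ▷ X ⊗≫
        P₁ ◁ (S ◁ d₂ ≫ (α_ S X P₂).inv ≫ dS ▷ P₂ ≫ (α_ X S P₂).hom ≫ X ◁ t₂) ⊗≫
          d₁ ▷ P₂ ▷ S ⊗≫ 𝟙 _ := by
      rw [whisker_exchange, ← whisker_exchange d₁]; bicategory
    _ = _ := by
      rw [h₂]; dsimp only [dext, dext']; bicategory

theorem YangBaxter.dext' {t : P ≫ Q ⟶ Q ≫ P}
    {dP : P ≫ X ⟶ X ≫ P} {eP : P ≫ Y ⟶ Y ≫ P} {dQ : Q ≫ X ⟶ X ≫ Q} {eQ : Q ≫ Y ⟶ Y ≫ Q}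
    (h₁ : YangBaxter t dP dQ) (h₂ : YangBaxter t eP eQ) :
    YangBaxter t (dext' dP eP) (dext' dQ eQ) := by
  unfold YangBaxter at *
  calc
    _ = 𝟙 _ ⊗≫ P ◁ dQ ▷ Y ⊗≫ ((P ≫ X) ◁ eQ ≫ dP ▷ (Y ≫ Q)) ⊗≫ X ◁ eP ▷ Q ⊗≫
        X ◁ Y ◁ t ⊗≫ 𝟙 _ := by
      dsimp only [Paper.dext']; bicategory
    _ = 𝟙 _ ⊗≫ P ◁ dQ ▷ Y ⊗≫ dP ▷ Q ▷ Y ⊗≫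
        X ◁ (P ◁ eQ ≫ (α_ P Y Q).inv ≫ eP ▷ Q ≫ (α_ Y P Q).hom ≫ Y ◁ t) ⊗≫ 𝟙 _ := by
      rw [whisker_exchange]; bicategory
    _ = 𝟙 _ ⊗≫ (P ◁ dQ ≫ (α_ P X Q).inv ≫ dP ▷ Q ≫ (α_ X P Q).hom ≫ X ◁ t) ▷ Y ⊗≫
        X ◁ Q ◁ eP ⊗≫ X ◁ eQ ▷ P ⊗≫ 𝟙 _ := by
      rw [h₂]; bicategory
    _ = 𝟙 _ ⊗≫ t ▷ X ▷ Y ⊗≫ Q ◁ dP ▷ Y ⊗≫ (dQ ▷ (P ≫ Y) ≫ (X ≫ Q) ◁ eP) ⊗≫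
        X ◁ eQ ▷ P ⊗≫ 𝟙 _ := by
      rw [h₁]; bicategory
    _ = _ := by
      rw [← whisker_exchange]; dsimp only [Paper.dext']; bicategory

theorem ActCompat.dext {t₁ : P₁ ≫ Q ⟶ Q ≫ P₁} {t₂ : P₂ ≫ Q ⟶ Q ≫ P₂}
    {d₁ : P₁ ≫ X ⟶ X ≫ P₁} {d₂ : P₂ ≫ X ⟶ X ≫ P₂} {aQ : Q ≫ X ⟶ X}
    (h₁ : ActCompat t₁ d₁ aQ) (h₂ : ActCompat t₂ d₂ aQ) :
    ActCompat (dext t₁ t₂) (dext d₁ d₂) aQ := by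
  unfold ActCompat at *
  calc
    _ = 𝟙 _ ⊗≫ P₁ ◁ (P₂ ◁ aQ ≫ d₂) ⊗≫ d₁ ▷ P₂ ⊗≫ 𝟙 _ := by
      dsimp only [Paper.dext]; bicategory
    _ = 𝟙 _ ⊗≫ P₁ ◁ t₂ ▷ X ⊗≫ P₁ ◁ Q ◁ d₂ ⊗≫ (P₁ ◁ aQ ≫ d₁) ▷ P₂ ⊗≫ 𝟙 _ := by
      rw [h₂]; bicategory
    _ = 𝟙 _ ⊗≫ P₁ ◁ t₂ ▷ X ⊗≫ ((P₁ ≫ Q) ◁ d₂ ≫ t₁ ▷ (X ≫ P₂)) ⊗≫ Q ◁ d₁ ▷ P₂ ⊗≫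
        aQ ▷ P₁ ▷ P₂ ⊗≫ 𝟙 _ := by
      rw [h₁]; bicategory
    _ = _ := by
      rw [whisker_exchange]; dsimp only [Paper.dext]; bicategory

theorem ActCompat.actT {tQ : S ≫ Q ⟶ Q ≫ S} {tP : S ≫ P ⟶ P ≫ S}
    {dX : S ≫ X ⟶ X ≫ S} {dY : S ≫ Y ⟶ Y ≫ S} {d : P ≫ X ⟶ X ≫ P}
    {aQ : Q ≫ X ⟶ X} {aP : P ≫ Y ⟶ Y}
    (hQ : ActCompat tQ dX aQ) (hP : ActCompat tP dY aP) (hY : YangBaxter tP dX d) :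
    ActCompat (dext' tQ tP) (dext' dX dY) (actT d aQ aP) := by
  unfold ActCompat YangBaxter at *
  calc
    _ = 𝟙 _ ⊗≫ S ◁ Q ◁ d ▷ Y ⊗≫ S ◁ aQ ▷ P ▷ Y ⊗≫ ((S ≫ X) ◁ aP ≫ dX ▷ Y) ⊗≫
        X ◁ dY ⊗≫ 𝟙 _ := by
      dsimp only [Paper.actT, dext']; bicategory
    _ = 𝟙 _ ⊗≫ S ◁ Q ◁ d ▷ Y ⊗≫ (S ◁ aQ ≫ dX) ▷ (P ≫ Y) ⊗≫ X ◁ (S ◁ aP ≫ dY) ⊗≫ 𝟙 _ := by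
      rw [whisker_exchange]; bicategory
    _ = 𝟙 _ ⊗≫ ((S ≫ Q) ◁ (d ▷ Y) ≫ tQ ▷ ((X ≫ P) ≫ Y)) ⊗≫ Q ◁ dX ▷ P ▷ Y ⊗≫
        (aQ ▷ (S ≫ P ≫ Y) ≫
          X ◁ ((α_ S P Y).inv ≫ tP ▷ Y ≫ (α_ P S Y).hom ≫ P ◁ dY)) ⊗≫ X ◁ aP ▷ S ⊗≫ 𝟙 _ := by
      rw [hQ, hP]; bicategory
    _ = 𝟙 _ ⊗≫ tQ ▷ P ▷ X ▷ Y ⊗≫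
        Q ◁ (S ◁ d ≫ (α_ S X P).inv ≫ dX ▷ P ≫ (α_ X S P).hom ≫ X ◁ tP) ▷ Y ⊗≫
          Q ◁ X ◁ P ◁ dY ⊗≫ aQ ▷ P ▷ Y ▷ S ⊗≫ X ◁ aP ▷ S ⊗≫ 𝟙 _ := by
      rw [whisker_exchange, ← whisker_exchange aQ]; bicategory
    _ = 𝟙 _ ⊗≫ tQ ▷ P ▷ X ▷ Y ⊗≫ Q ◁ tP ▷ X ▷ Y ⊗≫ Q ◁ P ◁ dX ▷ Y ⊗≫
        Q ◁ (d ▷ (S ≫ Y) ≫ (X ≫ P) ◁ dY) ⊗≫ aQ ▷ P ▷ Y ▷ S ⊗≫ X ◁ aP ▷ S ⊗≫ 𝟙 _ := by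
      rw [hY]; bicategory
    _ = _ := by
      rw [← whisker_exchange]; dsimp only [Paper.actT, dext']; bicategory

theorem NatCell.dext' {p : P ⟶ P'} {d₁ : P ≫ X ⟶ X ≫ P} {d₁' : P' ≫ X ⟶ X ≫ P'}
    {d₂ : P ≫ Y ⟶ Y ≫ P} {d₂' : P' ≫ Y ⟶ Y ≫ P'}
    (h₁ : NatCell p d₁ d₁') (h₂ : NatCell p d₂ d₂') :
    NatCell p (dext' d₁ d₂) (dext' d₁' d₂') := by
  unfold NatCell at *
  calc
    _ = 𝟙 _ ⊗≫ (p ▷ X ≫ d₁') ▷ Y ⊗≫ X ◁ d₂' ⊗≫ 𝟙 _ := by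
      dsimp only [Paper.dext']; bicategory
    _ = 𝟙 _ ⊗≫ d₁ ▷ Y ⊗≫ X ◁ (p ▷ Y ≫ d₂') ⊗≫ 𝟙 _ := by
      rw [h₁]; bicategory
    _ = _ := by
      rw [h₂]; dsimp only [Paper.dext']; bicategory

theorem NatCell.whiskerLeft {p : P ⟶ P'} {d : P ≫ X ⟶ X ≫ P} {d' : P' ≫ X ⟶ X ≫ P'}
    (h : NatCell p d d') (dS : S ≫ X ⟶ X ≫ S) :
    NatCell (S ◁ p) (dext dS d) (dext dS d') := by
  unfold NatCell at *
  calc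
    _ = 𝟙 _ ⊗≫ S ◁ (p ▷ X ≫ d') ⊗≫ dS ▷ P' ⊗≫ 𝟙 _ := by
      dsimp only [dext]; bicategory
    _ = 𝟙 _ ⊗≫ S ◁ d ⊗≫ ((S ≫ X) ◁ p ≫ dS ▷ P') ⊗≫ 𝟙 _ := by
      rw [h]; bicategory
    _ = _ := by
      rw [whisker_exchange]; dsimp only [dext]; bicategory

theorem NatCell.whiskerRight {p : P ⟶ P'} {d : P ≫ X ⟶ X ≫ P} {d' : P' ≫ X ⟶ X ≫ P'}
    (h : NatCell p d d') (dS : S ≫ X ⟶ X ≫ S) :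
    NatCell (p ▷ S) (dext d dS) (dext d' dS) := by
  unfold NatCell at *
  calc
    _ = 𝟙 _ ⊗≫ (p ▷ (S ≫ X) ≫ P' ◁ dS) ⊗≫ d' ▷ S ⊗≫ 𝟙 _ := by
      dsimp only [dext]; bicategory
    _ = 𝟙 _ ⊗≫ P ◁ dS ⊗≫ (p ▷ X ≫ d') ▷ S ⊗≫ 𝟙 _ := by
      rw [← whisker_exchange]; bicategory
    _ = _ := by
      rw [h]; dsimp only [dext]; bicategory

theorem NatElt.dext' {u : 𝟙 a ⟶ P} {d₁ : P ≫ X ⟶ X ≫ P} {d₂ : P ≫ Y ⟶ Y ≫ P}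
    (h₁ : NatElt u d₁) (h₂ : NatElt u d₂) : NatElt u (dext' d₁ d₂) := by
  unfold NatElt at *
  symm
  calc
    _ = 𝟙 _ ⊗≫ ((λ_ X).inv ≫ u ▷ X ≫ d₁) ▷ Y ⊗≫ X ◁ d₂ ⊗≫ 𝟙 _ := by
      dsimp only [Paper.dext']; bicategory
    _ = 𝟙 _ ⊗≫ X ◁ ((λ_ Y).inv ≫ u ▷ Y ≫ d₂) ⊗≫ 𝟙 _ := by
      rw [← h₁]; bicategory
    _ = _ := by
      rw [← h₂]; bicategory

theorem NatElt.tunit {u : 𝟙 a ⟶ P₁} {v : 𝟙 a ⟶ P₂} {d₁ : P₁ ≫ X ⟶ X ≫ P₁}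
    {d₂ : P₂ ≫ X ⟶ X ≫ P₂} (h₁ : NatElt u d₁) (h₂ : NatElt v d₂) :
    NatElt (tunit u v) (dext d₁ d₂) := by
  unfold NatElt at *
  symm
  calc
    _ = 𝟙 _ ⊗≫ u ▷ X ⊗≫ P₁ ◁ ((λ_ X).inv ≫ v ▷ X ≫ d₂) ⊗≫ d₁ ▷ P₂ ⊗≫ 𝟙 _ := by
      dsimp only [Paper.tunit, dext]; bicategory
    _ = 𝟙 _ ⊗≫ u ▷ X ⊗≫ ((P₁ ≫ X) ◁ v ≫ d₁ ▷ P₂) ⊗≫ 𝟙 _ := by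
      rw [← h₂]; bicategory
    _ = 𝟙 _ ⊗≫ ((λ_ X).inv ≫ u ▷ X ≫ d₁) ⊗≫ X ◁ P₁ ◁ v ⊗≫ 𝟙 _ := by
      rw [whisker_exchange]; bicategory
    _ = _ := by
      rw [← h₁]; dsimp only [Paper.tunit]; bicategory

theorem dext'_counit {c : P ⟶ 𝟙 a} {d₁ : P ≫ X ⟶ X ≫ P} {d₂ : P ≫ Y ⟶ Y ≫ P}
    (h₁ : d₁ ≫ X ◁ c ≫ (ρ_ X).hom = c ▷ X ≫ (λ_ X).hom)
    (h₂ : d₂ ≫ Y ◁ c ≫ (ρ_ Y).hom = c ▷ Y ≫ (λ_ Y).hom) :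
    dext' d₁ d₂ ≫ (X ≫ Y) ◁ c ≫ (ρ_ (X ≫ Y)).hom = c ▷ (X ≫ Y) ≫ (λ_ (X ≫ Y)).hom := by
  calc
    _ = 𝟙 _ ⊗≫ d₁ ▷ Y ⊗≫ X ◁ (d₂ ≫ Y ◁ c ≫ (ρ_ Y).hom) := by
      dsimp only [dext']; bicategory
    _ = 𝟙 _ ⊗≫ (d₁ ≫ X ◁ c ≫ (ρ_ X).hom) ▷ Y := by
      rw [h₂]; bicategory
    _ = _ := by
      rw [h₁]; bicategory

theorem eltAct_tunit {u : 𝟙 a ⟶ Q} {v : 𝟙 a ⟶ P} {d : P ≫ X ⟶ X ≫ P} (h : NatElt v d)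
    (aQ : Q ≫ X ⟶ X) (aP : P ≫ Y ⟶ Y) :
    eltAct (tunit u v) (actT d aQ aP) = eltAct u aQ ▷ Y ≫ X ◁ eltAct v aP := by
  unfold NatElt at h
  calc
    _ = 𝟙 _ ⊗≫ u ▷ X ▷ Y ⊗≫ Q ◁ ((λ_ X).inv ≫ v ▷ X ≫ d) ▷ Y ⊗≫ aQ ▷ P ▷ Y ⊗≫ X ◁ aP := by
      dsimp only [eltAct, tunit, actT]; bicategory
    _ = 𝟙 _ ⊗≫ u ▷ X ▷ Y ⊗≫ ((Q ≫ X) ◁ (v ▷ Y) ≫ aQ ▷ (P ≫ Y)) ⊗≫ X ◁ aP := by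
      rw [← h]; bicategory
    _ = _ := by
      rw [whisker_exchange]; dsimp only [eltAct]; bicategory

theorem IsAct.eltAct_conv {m : T ≫ T ⟶ T} {act : T ≫ Y ⟶ Y} (h : IsAct m act)
    (f g : 𝟙 a ⟶ T) : eltAct (conv m f g) act = eltAct g act ≫ eltAct f act := by
  unfold IsAct at h
  calc
    _ = 𝟙 _ ⊗≫ f ▷ Y ⊗≫ T ◁ ((λ_ Y).inv ≫ g ▷ Y) ⊗≫ ((α_ T T Y).inv ≫ m ▷ Y ≫ act) := by
      dsimp only [eltAct, conv]; bicategory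
    _ = 𝟙 _ ⊗≫ (f ▷ Y ≫ T ◁ eltAct g act) ⊗≫ act := by
      rw [h]; dsimp only [eltAct]; bicategory
    _ = _ := by
      rw [← whisker_exchange]; dsimp only [eltAct]; bicategory

theorem IsAct.comp_eltAct {m : T ≫ T ⟶ T} {act : T ≫ Y ⟶ Y} (h : IsAct m act)
    {φ : 𝟙 a ⟶ T} {c₁ c₂ : P ⟶ T}
    (hc : c₁ ≫ (λ_ T).inv ≫ φ ▷ T ≫ m = c₂ ≫ (ρ_ T).inv ≫ T ◁ φ ≫ m) :
    c₁ ▷ Y ≫ act ≫ eltAct φ act = P ◁ eltAct φ act ≫ c₂ ▷ Y ≫ act := by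
  unfold IsAct at h
  calc
    _ = 𝟙 _ ⊗≫ c₁ ▷ Y ⊗≫ (𝟙 a ◁ act ≫ φ ▷ Y) ⊗≫ act := by
      dsimp only [eltAct]; bicategory
    _ = 𝟙 _ ⊗≫ c₁ ▷ Y ⊗≫ φ ▷ T ▷ Y ⊗≫ (T ◁ act ≫ act) := by
      rw [whisker_exchange]; bicategory
    _ = (c₁ ≫ (λ_ T).inv ≫ φ ▷ T ≫ m) ▷ Y ⊗≫ act := by
      rw [← h]; bicategory
    _ = 𝟙 _ ⊗≫ c₂ ▷ Y ⊗≫ T ◁ φ ▷ Y ⊗≫ ((α_ T T Y).inv ≫ m ▷ Y ≫ act) := by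
      rw [hc]; bicategory
    _ = 𝟙 _ ⊗≫ (c₂ ▷ Y ≫ T ◁ eltAct φ act) ⊗≫ act := by
      rw [h]; dsimp only [eltAct]; bicategory
    _ = _ := by
      rw [← whisker_exchange]; bicategory

theorem ActCompat.whiskerLeft_eltAct {t : S ≫ T ⟶ T ≫ S} {d : S ≫ Y ⟶ Y ≫ S}
    {act : T ≫ Y ⟶ Y} (h : ActCompat t d act) {φ : 𝟙 a ⟶ T}
    (hφ : (λ_ S).inv ≫ φ ▷ S = (ρ_ S).inv ≫ S ◁ φ ≫ t) :
    d ≫ eltAct φ act ▷ S = S ◁ eltAct φ act ≫ d := by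
  unfold ActCompat at h
  symm
  calc
    _ = 𝟙 _ ⊗≫ S ◁ φ ▷ Y ⊗≫ (S ◁ act ≫ d) := by
      dsimp only [eltAct]; bicategory
    _ = 𝟙 _ ⊗≫ ((ρ_ S).inv ≫ S ◁ φ ≫ t) ▷ Y ⊗≫ T ◁ d ⊗≫ act ▷ S := by
      rw [h]; bicategory
    _ = 𝟙 _ ⊗≫ (φ ▷ (S ≫ Y) ≫ T ◁ d) ⊗≫ act ▷ S := by
      rw [← hφ]; bicategory
    _ = _ := by
      rw [← whisker_exchange]; dsimp only [eltAct]; bicategory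

theorem eltAct_naturality {u : 𝟙 a ⟶ T} {aY : T ≫ Y ⟶ Y} {aZ : T ≫ Z ⟶ Z} {f : Y ⟶ Z}
    (h : T ◁ f ≫ aZ = aY ≫ f) : eltAct u aY ≫ f = f ≫ eltAct u aZ := by
  calc
    _ = (λ_ Y).inv ≫ u ▷ Y ≫ aY ≫ f := by simp [eltAct]
    _ = 𝟙 _ ⊗≫ (u ▷ Y ≫ T ◁ f) ⊗≫ aZ := by rw [← h]; bicategory
    _ = _ := by rw [← whisker_exchange]; dsimp only [eltAct]; bicategory

theorem eltAct_comp (u : 𝟙 a ⟶ P) (p : P ⟶ T) (act : T ≫ Y ⟶ Y) :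
    eltAct (u ≫ p) act = eltAct u (p ▷ Y ≫ act) := by
  simp [eltAct]

theorem actT_comp_right {p : P ⟶ P'} {d : P ≫ X ⟶ X ≫ P} {d' : P' ≫ X ⟶ X ≫ P'}
    (h : NatCell p d d') (aQ : Q ≫ X ⟶ X) (aP : P' ≫ Y ⟶ Y) :
    actT d aQ (p ▷ Y ≫ aP) = (Q ◁ p) ▷ (X ≫ Y) ≫ actT d' aQ aP := by
  unfold NatCell at h
  symm
  calc
    _ = 𝟙 _ ⊗≫ Q ◁ (p ▷ X ≫ d') ▷ Y ⊗≫ aQ ▷ P' ▷ Y ⊗≫ X ◁ aP := by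
      dsimp only [actT]; bicategory
    _ = 𝟙 _ ⊗≫ Q ◁ d ▷ Y ⊗≫ ((Q ≫ X) ◁ (p ▷ Y) ≫ aQ ▷ (P' ≫ Y)) ⊗≫ X ◁ aP := by
      rw [h]; bicategory
    _ = _ := by
      rw [whisker_exchange]; dsimp only [actT]; bicategory

theorem actT_comp_left (q : Q ⟶ Q') (d : P ≫ X ⟶ X ≫ P) (aQ : Q' ≫ X ⟶ X) (aP : P ≫ Y ⟶ Y) :
    actT d (q ▷ X ≫ aQ) aP = (q ▷ P) ▷ (X ≫ Y) ≫ actT d aQ aP := by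
  symm
  calc
    _ = 𝟙 _ ⊗≫ (q ▷ ((P ≫ X) ≫ Y) ≫ Q' ◁ (d ▷ Y)) ⊗≫ aQ ▷ P ▷ Y ⊗≫ X ◁ aP := by
      dsimp only [actT]; bicategory
    _ = _ := by
      rw [← whisker_exchange]; dsimp only [actT]; bicategory

theorem actT_naturality {d : P ≫ X ⟶ X ≫ P} {d' : P ≫ X' ⟶ X' ≫ P} {aQ : Q ≫ X ⟶ X}
    {aQ' : Q ≫ X' ⟶ X'} {aP : P ≫ Y ⟶ Y} {aP' : P ≫ Y' ⟶ Y'} {f : X ⟶ X'} {g : Y ⟶ Y'}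
    (hd : P ◁ f ≫ d' = d ≫ f ▷ P) (hf : Q ◁ f ≫ aQ' = aQ ≫ f) (hg : P ◁ g ≫ aP' = aP ≫ g) :
    (Q ≫ P) ◁ (f ▷ Y ≫ X' ◁ g) ≫ actT d' aQ' aP' = actT d aQ aP ≫ f ▷ Y ≫ X' ◁ g := by
  calc
    _ = 𝟙 _ ⊗≫ Q ◁ P ◁ f ▷ Y ⊗≫ Q ◁ ((P ≫ X') ◁ g ≫ d' ▷ Y') ⊗≫ aQ' ▷ P ▷ Y' ⊗≫
        X' ◁ aP' := by
      dsimp only [actT]; bicategory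
    _ = 𝟙 _ ⊗≫ Q ◁ (P ◁ f ≫ d') ▷ Y ⊗≫ ((Q ≫ X') ◁ (P ◁ g) ≫ aQ' ▷ (P ≫ Y')) ⊗≫
        X' ◁ aP' := by
      rw [whisker_exchange]; bicategory
    _ = 𝟙 _ ⊗≫ Q ◁ d ▷ Y ⊗≫ (Q ◁ f ≫ aQ') ▷ P ▷ Y ⊗≫ X' ◁ (P ◁ g ≫ aP') := by
      rw [hd, whisker_exchange]; bicategory
    _ = 𝟙 _ ⊗≫ Q ◁ d ▷ Y ⊗≫ aQ ▷ P ▷ Y ⊗≫ (f ▷ (P ≫ Y) ≫ X' ◁ aP) ⊗≫ X' ◁ g := by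
      rw [hf, hg]; bicategory
    _ = _ := by
      rw [← whisker_exchange]; dsimp only [actT]; bicategory

theorem dext_naturality {d₁ : P₁ ≫ X ⟶ X ≫ P₁} {d₂ : P₂ ≫ X ⟶ X ≫ P₂}
    {d₁' : P₁ ≫ X' ⟶ X' ≫ P₁} {d₂' : P₂ ≫ X' ⟶ X' ≫ P₂} {f : X ⟶ X'}
    (h₁ : P₁ ◁ f ≫ d₁' = d₁ ≫ f ▷ P₁) (h₂ : P₂ ◁ f ≫ d₂' = d₂ ≫ f ▷ P₂) :
    (P₁ ≫ P₂) ◁ f ≫ dext d₁' d₂' = dext d₁ d₂ ≫ f ▷ (P₁ ≫ P₂) := by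
  calc
    _ = 𝟙 _ ⊗≫ P₁ ◁ (P₂ ◁ f ≫ d₂') ⊗≫ d₁' ▷ P₂ ⊗≫ 𝟙 _ := by
      dsimp only [dext]; bicategory
    _ = 𝟙 _ ⊗≫ P₁ ◁ d₂ ⊗≫ (P₁ ◁ f ≫ d₁') ▷ P₂ ⊗≫ 𝟙 _ := by
      rw [h₂]; bicategory
    _ = _ := by
      rw [h₁]; dsimp only [dext]; bicategory

theorem actT_comp_whiskerLeft (d : P ≫ X ⟶ X ≫ P) (aQ : Q ≫ X ⟶ X) {g : Y ⟶ Z}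
    (aP : P ≫ Z ⟶ Z) {aP' : P ≫ Y ⟶ Y} (h : aP' ≫ g = P ◁ g ≫ aP) :
    actT d aQ aP' ≫ X ◁ g = (Q ≫ P) ◁ (X ◁ g) ≫ actT d aQ aP := by
  symm
  calc
    _ = 𝟙 _ ⊗≫ Q ◁ ((P ≫ X) ◁ g ≫ d ▷ Z) ⊗≫ aQ ▷ P ▷ Z ⊗≫ X ◁ aP := by
      dsimp only [actT]; bicategory
    _ = 𝟙 _ ⊗≫ Q ◁ d ▷ Y ⊗≫ ((Q ≫ X) ◁ (P ◁ g) ≫ aQ ▷ (P ≫ Z)) ⊗≫ X ◁ aP := by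
      rw [whisker_exchange]; bicategory
    _ = 𝟙 _ ⊗≫ Q ◁ d ▷ Y ⊗≫ aQ ▷ P ▷ Y ⊗≫ X ◁ (P ◁ g ≫ aP) := by
      rw [whisker_exchange]; bicategory
    _ = _ := by
      rw [← h]; dsimp only [actT]; bicategory

theorem actT_comp_right_whiskerLeft {p : P ⟶ P'} {d : P ≫ X ⟶ X ≫ P} {d' : P' ≫ X ⟶ X ≫ P'}
    (hp : NatCell p d d') (aQ : Q ≫ X ⟶ X) {aP : P ≫ Y ⟶ Y} {aP' : P' ≫ Z ⟶ Z} {g : Y ⟶ Z}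
    (h : aP ≫ g = p ▷ Y ≫ P' ◁ g ≫ aP') :
    actT d aQ aP ≫ X ◁ g = (Q ◁ p) ▷ (X ≫ Y) ≫ (Q ≫ P') ◁ (X ◁ g) ≫ actT d' aQ aP' := by
  rw [actT_comp_whiskerLeft d aQ (p ▷ Z ≫ aP') (by rw [h, whisker_exchange_assoc]),
    actT_comp_right hp, whisker_exchange_assoc]

theorem eltAct_semilinear {u : 𝟙 a ⟶ P} {r : P ⟶ T} {aY : P ≫ Y ⟶ Y} {aZ : T ≫ Z ⟶ Z}
    {f : Y ⟶ Z} (h : aY ≫ f = r ▷ Y ≫ T ◁ f ≫ aZ) :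
    eltAct u aY ≫ f = f ≫ eltAct (u ≫ r) aZ := by
  rw [eltAct_comp]
  exact eltAct_naturality (by rw [h, whisker_exchange_assoc])

theorem IsAct.comp {m : T ≫ T ⟶ T} {n : Q ≫ Q ⟶ Q} {act : T ≫ Y ⟶ Y} (h : IsAct m act)
    {c : Q ⟶ T} (hc : n ≫ c = c ▷ Q ≫ T ◁ c ≫ m) : IsAct n (c ▷ Y ≫ act) := by
  unfold IsAct at *
  calc
    _ = 𝟙 _ ⊗≫ (n ≫ c) ▷ Y ⊗≫ act := by bicategory
    _ = 𝟙 _ ⊗≫ (c ▷ (Q ≫ Y) ≫ T ◁ (c ▷ Y)) ⊗≫ ((α_ T T Y).inv ≫ m ▷ Y ≫ act) := by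
      rw [hc]; bicategory
    _ = 𝟙 _ ⊗≫ Q ◁ c ▷ Y ⊗≫ (c ▷ (T ≫ Y) ≫ T ◁ act) ⊗≫ act := by
      rw [h, ← whisker_exchange]; bicategory
    _ = _ := by
      rw [← whisker_exchange]; bicategory

theorem ActCompat.comp {t : S ≫ Q ⟶ Q ≫ S} {t' : S ≫ T ⟶ T ≫ S} {d : S ≫ X ⟶ X ≫ S}
    {act : T ≫ X ⟶ X} (h : ActCompat t' d act) {c : Q ⟶ T} (hc : S ◁ c ≫ t' = t ≫ c ▷ S) :
    ActCompat t d (c ▷ X ≫ act) := by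
  unfold ActCompat at *
  calc
    _ = 𝟙 _ ⊗≫ S ◁ c ▷ X ⊗≫ (S ◁ act ≫ d) := by bicategory
    _ = 𝟙 _ ⊗≫ (S ◁ c ≫ t') ▷ X ⊗≫ T ◁ d ⊗≫ act ▷ S := by
      rw [h]; bicategory
    _ = 𝟙 _ ⊗≫ t ▷ X ⊗≫ (c ▷ (S ≫ X) ≫ T ◁ d) ⊗≫ act ▷ S := by
      rw [hc]; bicategory
    _ = _ := by
      rw [← whisker_exchange]; bicategory

theorem NatCell.counit_whiskerRight {c : P ⟶ 𝟙 a} {d : P ≫ X ⟶ X ≫ P}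
    (hc : d ≫ X ◁ c ≫ (ρ_ X).hom = c ▷ X ≫ (λ_ X).hom) (d' : Q ≫ X ⟶ X ≫ Q) :
    NatCell (c ▷ Q ≫ (λ_ Q).hom) (dext d d') d' := by
  unfold NatCell
  symm
  calc
    _ = 𝟙 _ ⊗≫ P ◁ d' ⊗≫ (d ≫ X ◁ c ≫ (ρ_ X).hom) ▷ Q := by
      dsimp only [dext]; bicategory
    _ = 𝟙 _ ⊗≫ (P ◁ d' ≫ c ▷ (X ≫ Q)) ⊗≫ 𝟙 _ := by
      rw [hc]; bicategory
    _ = _ := by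
      rw [whisker_exchange]; bicategory

theorem actT_unit_left (c : Q ⟶ 𝟙 a) (aY : P ≫ Y ⟶ Y) :
    actT ((ρ_ P).hom ≫ (λ_ P).inv) ((ρ_ Q).hom ≫ c) aY ≫ (λ_ Y).hom =
      (c ▷ P ≫ (λ_ P).hom) ▷ (𝟙 a ≫ Y) ≫ P ◁ (λ_ Y).hom ≫ aY := by
  dsimp only [actT]; bicategory

theorem actT_unit_right {c : P ⟶ 𝟙 a} {d : P ≫ X ⟶ X ≫ P}
    (hc : d ≫ X ◁ c ≫ (ρ_ X).hom = c ▷ X ≫ (λ_ X).hom) (aX : Q ≫ X ⟶ X) :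
    actT d aX ((ρ_ P).hom ≫ c) ≫ (ρ_ X).hom =
      (Q ◁ c ≫ (ρ_ Q).hom) ▷ (X ≫ 𝟙 a) ≫ Q ◁ (ρ_ X).hom ≫ aX := by
  calc
    _ = 𝟙 _ ⊗≫ Q ◁ d ⊗≫ (aX ▷ P ≫ X ◁ c) ⊗≫ 𝟙 _ := by
      dsimp only [actT]; bicategory
    _ = 𝟙 _ ⊗≫ Q ◁ (d ≫ X ◁ c ≫ (ρ_ X).hom) ⊗≫ aX := by
      rw [← whisker_exchange]; bicategory
    _ = _ := by
      rw [hc]; bicategory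

theorem pentagon_conj {u₁ : (X ≫ Y) ≫ Z ≫ T ⟶ (X ≫ Y) ≫ Z ≫ T} {v₁ : X ≫ Y ≫ Z ⟶ X ≫ Y ≫ Z}
    {v₂ : X ≫ (Y ≫ Z) ≫ T ⟶ X ≫ (Y ≫ Z) ≫ T} {v₃ : Y ≫ Z ≫ T ⟶ Y ≫ Z ≫ T}
    {u₂ w₁ w₂ w₃ : X ≫ Y ≫ Z ≫ T ⟶ X ≫ Y ≫ Z ≫ T}
    (h₁ : u₁ ≫ (α_ X Y (Z ≫ T)).hom = (α_ X Y (Z ≫ T)).hom ≫ w₁)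
    (h₂ : v₁ ▷ T ≫ (α_ X (Y ≫ Z) T).hom ≫ X ◁ (α_ Y Z T).hom =
      ((α_ X (Y ≫ Z) T).hom ≫ X ◁ (α_ Y Z T).hom) ≫ w₂)
    (h₃ : v₂ ≫ X ◁ (α_ Y Z T).hom = X ◁ (α_ Y Z T).hom ≫ w₃)
    (hw : w₂ ≫ w₃ ≫ X ◁ v₃ = w₁ ≫ u₂) :
    ((α_ (X ≫ Y) Z T).hom ≫ u₁) ≫ (α_ X Y (Z ≫ T)).hom ≫ u₂ =
      ((α_ X Y Z).hom ≫ v₁) ▷ T ≫ ((α_ X (Y ≫ Z) T).hom ≫ v₂) ≫ X ◁ ((α_ Y Z T).hom ≫ v₃) := by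
  simp only [comp_whiskerRight, whiskerLeft_comp, Category.assoc] at h₂ ⊢
  rw [reassoc_of% h₁, reassoc_of% h₃, reassoc_of% h₂, hw, pentagon_assoc]

end Laws

/-! ### Tambara modules -/

variable {Q : QuasiBimonad a} {M N P R : QBModData Q}

/-- The action of `E ≫ E ≫ E` on a triple composite. -/
abbrev act3 (M N P : QBModData Q) : (Q.E ≫ Q.E ≫ Q.E) ≫ M.X ≫ N.X ≫ P.X ⟶ M.X ≫ N.X ≫ P.X :=
  actT (dext M.d M.d) M.act (actT N.d N.act P.act)

/-- The action of `E ≫ E ≫ E ≫ E` on a quadruple composite. -/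
abbrev act4 (M N P R : QBModData Q) :
    (Q.E ≫ Q.E ≫ Q.E ≫ Q.E) ≫ M.X ≫ N.X ≫ P.X ≫ R.X ⟶ M.X ≫ N.X ≫ P.X ≫ R.X :=
  actT (dext M.d (dext M.d M.d)) M.act (act3 N P R)

theorem qbAssoc_eq (M N P : QBModData Q) :
    qbAssoc Q M N P = (α_ M.X N.X P.X).hom ≫ eltAct Q.Φ (act3 M N P) := rfl

namespace IsQBMod

theorem mulCompat (h : IsQBMod Q M) : MulCompat Q.mul M.d := h.1

theorem natElt_unit (h : IsQBMod Q M) : NatElt Q.unit M.d := h.2.1.symm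

theorem natCell_comul (h : IsQBMod Q M) : NatCell Q.comul M.d (dext M.d M.d) := h.2.2.1

theorem counit (h : IsQBMod Q M) :
    M.d ≫ M.X ◁ Q.counit ≫ (ρ_ M.X).hom = Q.counit ▷ M.X ≫ (λ_ M.X).hom := h.2.2.2.1

theorem natElt_Φ (h : IsQBMod Q M) : NatElt Q.Φ (dext M.d (dext M.d M.d)) := h.2.2.2.2.1

theorem yangBaxter (h : IsQBMod Q M) : YangBaxter Q.τ M.d M.d := h.2.2.2.2.2.1

theorem isAct (h : IsQBMod Q M) : IsAct Q.mul M.act := h.2.2.2.2.2.2.1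

theorem eltAct_unit (h : IsQBMod Q M) : eltAct Q.unit M.act = 𝟙 M.X := h.2.2.2.2.2.2.2.1

theorem actCompat (h : IsQBMod Q M) : ActCompat Q.τ M.d M.act := h.2.2.2.2.2.2.2.2

theorem isAct_actT (hM : IsQBMod Q M) (hN : IsQBMod Q N) :
    IsAct (tmul Q.mul Q.mul Q.τ) (actT M.d M.act N.act) :=
  hM.isAct.actT hN.isAct hM.mulCompat hM.actCompat

theorem isAct_act3 (hM : IsQBMod Q M) (hN : IsQBMod Q N) (hP : IsQBMod Q P) :
    IsAct (mul3 Q.mul Q.τ) (act3 M N P) :=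
  hM.isAct.actT (hN.isAct_actT hP) (hM.mulCompat.dext hM.mulCompat hM.yangBaxter)
    (hM.actCompat.dext hM.actCompat)

theorem isAct_act4 (hM : IsQBMod Q M) (hN : IsQBMod Q N) (hP : IsQBMod Q P)
    (hR : IsQBMod Q R) : IsAct (mul4 Q.mul Q.τ) (act4 M N P R) :=
  hM.isAct.actT (hN.isAct_act3 hP hR)
    (hM.mulCompat.dext (hM.mulCompat.dext hM.mulCompat hM.yangBaxter) (hM.yangBaxter.dext_left hM.yangBaxter))
    (hM.actCompat.dext (hM.actCompat.dext hM.actCompat))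

theorem actCompat_act3 (hM : IsQBMod Q M) (hN : IsQBMod Q N) (hP : IsQBMod Q P) :
    ActCompat (dext' Q.τ (dext' Q.τ Q.τ)) (dext' M.d (dext' N.d P.d)) (act3 M N P) :=
  hM.actCompat.actT (hN.actCompat.actT hP.actCompat hN.yangBaxter)
    (hM.yangBaxter.dext_right hM.yangBaxter)

theorem eltAct_tunit_unit (hM : IsQBMod Q M) (hN : IsQBMod Q N) :
    eltAct (tunit Q.unit Q.unit) (actT M.d M.act N.act) = 𝟙 _ := by
  rw [eltAct_tunit hM.natElt_unit, hM.eltAct_unit, hN.eltAct_unit]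
  simp

theorem eltAct_one3 (hM : IsQBMod Q M) (hN : IsQBMod Q N) (hP : IsQBMod Q P) :
    eltAct (tunit Q.unit (tunit Q.unit Q.unit)) (act3 M N P) = 𝟙 _ := by
  rw [eltAct_tunit (hM.natElt_unit.tunit hM.natElt_unit), hM.eltAct_unit,
    hN.eltAct_tunit_unit hP]
  simp

theorem tensor (hM : IsQBMod Q M) (hN : IsQBMod Q N) : IsQBMod Q (qbTensor Q M N) := by
  refine ⟨hM.mulCompat.dext' hN.mulCompat, (hM.natElt_unit.dext' hN.natElt_unit).symm, ?_,
    dext'_counit hM.counit hN.counit, ?_, hM.yangBaxter.dext' hN.yangBaxter,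
    (hM.isAct_actT hN).comp Q.mul_comul, ?_, ?_⟩
  · have h := hM.natCell_comul.dext' hN.natCell_comul
    rw [← dext_dext'] at h
    exact h
  · have h := hM.natElt_Φ.dext' hN.natElt_Φ
    rw [← dext_dext', ← dext_dext'] at h
    exact h
  · have h := hM.eltAct_tunit_unit hN
    rw [← Q.comul_unit, eltAct_comp] at h
    exact h
  · refine (hM.actCompat.actT hN.actCompat hM.yangBaxter).comp (t := Q.τ) ?_
    have h := Q.τ_rc =≫ (α_ Q.E Q.E Q.E).inv
    simpa [dext'] using h

theorem act3_tensor_left (M N P R : QBModData Q) :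
    act3 (qbTensor Q M N) P R ≫ (α_ M.X N.X (P.X ≫ R.X)).hom =
      (Q.comul ▷ (Q.E ≫ Q.E) ≫ (α_ Q.E Q.E (Q.E ≫ Q.E)).hom) ▷ ((M.X ≫ N.X) ≫ P.X ≫ R.X) ≫
        (Q.E ≫ Q.E ≫ Q.E ≫ Q.E) ◁ (α_ M.X N.X (P.X ≫ R.X)).hom ≫ act4 M N P R := by
  have h := actT_assoc M.d (dext M.d M.d) (dext N.d N.d) M.act N.act (actT P.d P.act R.act)
  rw [← dext_dext'] at h
  dsimp only [act3, act4, qbTensor]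
  rw [actT_comp_left, Category.assoc, h, comp_whiskerRight, Category.assoc]

theorem act3_tensor_right (hM : IsQBMod Q M) (hN : IsQBMod Q N) (P R : QBModData Q) :
    act3 M N (qbTensor Q P R) =
      (Q.E ◁ (Q.E ◁ Q.comul)) ▷ (M.X ≫ N.X ≫ P.X ≫ R.X) ≫ act4 M N P R := by
  dsimp only [act3, act4, qbTensor]
  rw [actT_comp_right hN.natCell_comul, actT_comp_right (hM.natCell_comul.whiskerLeft M.d)]

theorem actT_dext_assoc (M N P R : QBModData Q) :
    actT (dext (dext M.d M.d) M.d) M.act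
        (actT (dext' N.d P.d) (actT N.d N.act P.act) R.act) ≫ M.X ◁ (α_ N.X P.X R.X).hom =
      (Q.E ◁ (α_ Q.E Q.E Q.E).hom) ▷ (M.X ≫ (N.X ≫ P.X) ≫ R.X) ≫
        (Q.E ≫ Q.E ≫ Q.E ≫ Q.E) ◁ (M.X ◁ (α_ N.X P.X R.X).hom) ≫ act4 M N P R :=
  actT_comp_right_whiskerLeft (dext_assoc M.d M.d M.d) M.act
    (actT_assoc N.d N.d P.d N.act P.act R.act)

theorem act3_tensor_middle (hM : IsQBMod Q M) (N P R : QBModData Q) :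
    act3 M (qbTensor Q N P) R ≫ M.X ◁ (α_ N.X P.X R.X).hom =
      (Q.E ◁ (Q.comul ▷ Q.E) ≫ Q.E ◁ (α_ Q.E Q.E Q.E).hom) ▷ (M.X ≫ (N.X ≫ P.X) ≫ R.X) ≫
        (Q.E ≫ Q.E ≫ Q.E ≫ Q.E) ◁ (M.X ◁ (α_ N.X P.X R.X).hom) ≫ act4 M N P R := by
  dsimp only [act3, qbTensor]
  rw [actT_comp_left, actT_comp_right (hM.natCell_comul.whiskerRight M.d), Category.assoc]
  erw [actT_dext_assoc]
  rw [comp_whiskerRight, Category.assoc]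

theorem act3_whiskerRight (M N P R : QBModData Q) :
    actT (dext' M.d (dext' N.d P.d)) (act3 M N P) R.act ≫
        (α_ M.X (N.X ≫ P.X) R.X).hom ≫ M.X ◁ (α_ N.X P.X R.X).hom =
      ((α_ Q.E (Q.E ≫ Q.E) Q.E).hom ≫ Q.E ◁ (α_ Q.E Q.E Q.E).hom) ▷
          ((M.X ≫ N.X ≫ P.X) ≫ R.X) ≫
        (Q.E ≫ Q.E ≫ Q.E ≫ Q.E) ◁
          ((α_ M.X (N.X ≫ P.X) R.X).hom ≫ M.X ◁ (α_ N.X P.X R.X).hom) ≫ act4 M N P R := by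
  have h := actT_assoc (dext M.d M.d) M.d (dext' N.d P.d) M.act (actT N.d N.act P.act) R.act
  rw [reassoc_of% h, actT_dext_assoc, whisker_exchange_assoc]
  simp

theorem qbAssoc_pentagon (hM : IsQBMod Q M) (hN : IsQBMod Q N) (hP : IsQBMod Q P)
    (hR : IsQBMod Q R) :
    qbAssoc Q (qbTensor Q M N) P R ≫ qbAssoc Q M N (qbTensor Q P R) =
      qbAssoc Q M N P ▷ R.X ≫ qbAssoc Q M (qbTensor Q N P) R ≫ M.X ◁ qbAssoc Q N P R := by
  have h₁ : eltAct Q.Φ (act3 (qbTensor Q M N) P R) ≫ (α_ M.X N.X (P.X ≫ R.X)).hom = _ :=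
    eltAct_semilinear (act3_tensor_left M N P R)
  have h₂ : eltAct Q.Φ (act3 M N (qbTensor Q P R)) =
      eltAct (Q.Φ ≫ Q.E ◁ (Q.E ◁ Q.comul)) (act4 M N P R) :=
    (congrArg (eltAct Q.Φ) (hM.act3_tensor_right hN P R)).trans (eltAct_comp ..).symm
  have h₃ : eltAct Q.Φ (act3 M (qbTensor Q N P) R) ≫ M.X ◁ (α_ N.X P.X R.X).hom = _ :=
    eltAct_semilinear (hM.act3_tensor_middle N P R)
  have h₄ : M.X ◁ eltAct Q.Φ (act3 N P R) = eltAct (tunit Q.unit Q.Φ) (act4 M N P R) := by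
    rw [eltAct_tunit hM.natElt_Φ, hM.eltAct_unit]; simp
  have h₅ : eltAct Q.Φ (act3 M N P) ▷ R.X =
      eltAct (tunit Q.Φ Q.unit) (actT (dext' M.d (dext' N.d P.d)) (act3 M N P) R.act) := by
    rw [eltAct_tunit (hM.natElt_unit.dext' (hN.natElt_unit.dext' hP.natElt_unit)),
      hR.eltAct_unit]
    simp
  have h₆ := eltAct_semilinear (u := tunit Q.Φ Q.unit) (act3_whiskerRight M N P R)
  have hc := congrArg (fun u => eltAct u (act4 M N P R)) Q.cocycle
  simp only [(hM.isAct_act4 hN hP hR).eltAct_conv] at hc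
  rw [← h₅] at h₆
  rw [← h₂, ← h₄] at hc
  exact pentagon_conj h₁ h₆ h₃ hc

theorem qbAssoc_isIso (hM : IsQBMod Q M) (hN : IsQBMod Q N) (hP : IsQBMod Q P) :
    IsIso (qbAssoc Q M N P) := by
  obtain ⟨Φ', h₁, h₂⟩ := Q.Φ_inv
  have hA := hM.isAct_act3 hN hP
  have : IsIso (eltAct Q.Φ (act3 M N P)) :=
    ⟨eltAct Φ' (act3 M N P),
      by rw [← hA.eltAct_conv, h₂, hM.eltAct_one3 hN hP],
      by rw [← hA.eltAct_conv, h₁, hM.eltAct_one3 hN hP]⟩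
  rw [qbAssoc_eq]
  infer_instance

theorem qbAssoc_isQBHom (hM : IsQBMod Q M) (hN : IsQBMod Q N) (hP : IsQBMod Q P) :
    IsQBHom Q (qbTensor Q (qbTensor Q M N) P) (qbTensor Q M (qbTensor Q N P))
      (qbAssoc Q M N P) := by
  have hA := hM.isAct_act3 hN hP
  constructor
  · have h₁ : (qbTensor Q (qbTensor Q M N) P).act ≫ (α_ M.X N.X P.X).hom =
        Q.E ◁ (α_ M.X N.X P.X).hom ≫
          (Q.comul ≫ Q.comul ▷ Q.E ≫ (α_ Q.E Q.E Q.E).hom) ▷ (M.X ≫ N.X ≫ P.X) ≫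
            act3 M N P := by
      dsimp only [qbTensor]
      rw [actT_comp_left, Category.assoc, Category.assoc, actT_assoc, whisker_exchange_assoc]
      simp
    have h₂ : (qbTensor Q M (qbTensor Q N P)).act =
        (Q.comul ≫ Q.E ◁ Q.comul) ▷ (M.X ≫ N.X ≫ P.X) ≫ act3 M N P := by
      dsimp only [qbTensor]
      rw [actT_comp_right hM.natCell_comul]
      simp
    have h₃ := hA.comp_eltAct (φ := Q.Φ)
      (c₁ := Q.comul ≫ Q.comul ▷ Q.E ≫ (α_ Q.E Q.E Q.E).hom) (c₂ := Q.comul ≫ Q.E ◁ Q.comul)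
      (by simpa only [Category.assoc] using Q.quasi_coassoc)
    have key {act : Q.E ≫ (M.X ≫ N.X) ≫ P.X ⟶ (M.X ≫ N.X) ≫ P.X}
        (h : act ≫ (α_ M.X N.X P.X).hom = Q.E ◁ (α_ M.X N.X P.X).hom ≫
          (Q.comul ≫ Q.comul ▷ Q.E ≫ (α_ Q.E Q.E Q.E).hom) ▷ (M.X ≫ N.X ≫ P.X) ≫
            act3 M N P) :
        act ≫ (α_ M.X N.X P.X).hom ≫ eltAct Q.Φ (act3 M N P) =
          Q.E ◁ ((α_ M.X N.X P.X).hom ≫ eltAct Q.Φ (act3 M N P)) ≫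
            (Q.comul ≫ Q.E ◁ Q.comul) ▷ (M.X ≫ N.X ≫ P.X) ≫ act3 M N P := by
      rw [whiskerLeft_comp, Category.assoc, ← h₃, reassoc_of% h]
    rw [qbAssoc_eq, h₂]
    exact key h₁
  · have h := (hM.actCompat_act3 hN hP).whiskerLeft_eltAct Q.Φ_nat
    have h' := dext'_assoc M.d N.d P.d
    have key : dext' (dext' M.d N.d) P.d ≫
        ((α_ M.X N.X P.X).hom ≫ eltAct Q.Φ (act3 M N P)) ▷ Q.E =
        Q.E ◁ ((α_ M.X N.X P.X).hom ≫ eltAct Q.Φ (act3 M N P)) ≫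
          dext' M.d (dext' N.d P.d) := by
      rw [whiskerLeft_comp, comp_whiskerRight, ← reassoc_of% h', h, Category.assoc]
    exact key

theorem qbAssoc_naturality {M' N' P' : QBModData Q} {f : M.X ⟶ M'.X} {g : N.X ⟶ N'.X}
    {h : P.X ⟶ P'.X} (hf : IsQBHom Q M M' f) (hg : IsQBHom Q N N' g) (hh : IsQBHom Q P P' h) :
    qbAssoc Q M N P ≫ (f ▷ (N.X ≫ P.X) ≫ M'.X ◁ (g ▷ P.X ≫ N'.X ◁ h)) =
      ((f ▷ N.X ≫ M'.X ◁ g) ▷ P.X ≫ (M'.X ≫ N'.X) ◁ h) ≫ qbAssoc Q M' N' P' := by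
  have key := eltAct_naturality (u := Q.Φ)
    (actT_naturality (dext_naturality hf.2.symm hf.2.symm) hf.1.symm
      (actT_naturality hg.2.symm hg.1.symm hh.1.symm))
  rw [qbAssoc_eq, qbAssoc_eq, Category.assoc, key]
  simp

theorem qbUnit (Q : QuasiBimonad a) : IsQBMod Q (qbUnit Q) := by
  dsimp only [IsQBMod, Paper.qbUnit]
  refine ⟨by bicategory, by bicategory, by bicategory, by bicategory,
    by dsimp only [dext]; bicategory, by bicategory, ?_, ?_, ?_⟩
  · calc
      _ = 𝟙 _ ⊗≫ (Q.mul ≫ Q.counit) ⊗≫ 𝟙 _ := by bicategory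
      _ = _ := by rw [Q.counit_mul]; bicategory
  · calc
      _ = 𝟙 _ ⊗≫ (Q.unit ≫ Q.counit) ⊗≫ 𝟙 _ := by bicategory
      _ = _ := by rw [Q.counit_unit]; bicategory
  · calc
      _ = 𝟙 _ ⊗≫ (Q.E ◁ Q.counit ≫ (ρ_ Q.E).hom) ⊗≫ 𝟙 _ := by bicategory
      _ = _ := by rw [← Q.τ_lc_counit]; bicategory

theorem qbAssoc_triangle (hM : IsQBMod Q M) (hN : IsQBMod Q N) :
    qbAssoc Q M (Paper.qbUnit Q) N ≫ M.X ◁ (λ_ N.X).hom = (ρ_ M.X).hom ▷ N.X := by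
  have h₁ := actT_comp_right_whiskerLeft (NatCell.counit_whiskerRight hM.counit M.d) M.act
    (actT_unit_left Q.counit N.act)
  have h₂ : eltAct Q.Φ (act3 M (Paper.qbUnit Q) N) ≫ M.X ◁ (λ_ N.X).hom = _ :=
    eltAct_semilinear h₁
  have h₃ := Q.Φ_normal
  rw [← whiskerLeft_comp] at h₃
  rw [h₃, hM.eltAct_tunit_unit hN] at h₂
  rw [qbAssoc_eq, Category.assoc, h₂]
  simp [Paper.qbUnit]

theorem isQBHom_leftUnitor (M : QBModData Q) :
    IsQBHom Q (qbTensor Q (Paper.qbUnit Q) M) M (λ_ M.X).hom := by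
  constructor
  · dsimp only [qbTensor, Paper.qbUnit]
    rw [Category.assoc, actT_unit_left, ← comp_whiskerRight_assoc, Q.counit_comul]
    simp
  · dsimp only [qbTensor, Paper.qbUnit, dext']
    bicategory

theorem isQBHom_rightUnitor (hM : IsQBMod Q M) :
    IsQBHom Q (qbTensor Q M (Paper.qbUnit Q)) M (ρ_ M.X).hom := by
  constructor
  · dsimp only [qbTensor, Paper.qbUnit]
    rw [Category.assoc, actT_unit_right hM.counit, ← comp_whiskerRight_assoc, Q.comul_counit]
    simp
  · dsimp only [qbTensor, Paper.qbUnit, dext']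
    bicategory

end IsQBMod

/-- For a quasi-bimonad `(A, F, Φ)` in a 2-category `K` (such that
`τ_{F,Id_A}` is natural with respect to `Φ`), the category of left Tambara modules
over `(A, F, Φ)` is a (non-strict) monoidal category: the tensor product of two
Tambara modules is again a Tambara module, the unit object `(Id_A, id_F)` with the
trivial action is a Tambara module, the unit constraints are (the canonical)
identities and the associativity constraint `α_{X,Y,Z}` given by the action of `Φ`
is an invertible morphism of Tambara modules, natural in all three arguments, and
satisfies the pentagon and triangle identities. -/
theorem tambara_modules_over_quasi_bimonad_monoidal {K : Type*} [Bicategory K]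
    [Bicategory.Strict K] {a : K} (Q : QuasiBimonad a) :
    -- the tensor product of two Tambara modules is a Tambara module
    (∀ M N : QBModData Q, IsQBMod Q M → IsQBMod Q N → IsQBMod Q (qbTensor Q M N)) ∧
    -- the unit object is a Tambara module
    IsQBMod Q (qbUnit Q) ∧
    -- the associativity constraint is invertible
    (∀ M N P : QBModData Q, IsQBMod Q M → IsQBMod Q N → IsQBMod Q P →
      IsIso (qbAssoc Q M N P)) ∧
    -- the associativity constraint is a morphism of Tambara modules
    (∀ M N P : QBModData Q, IsQBMod Q M → IsQBMod Q N → IsQBMod Q P →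
      IsQBHom Q (qbTensor Q (qbTensor Q M N) P) (qbTensor Q M (qbTensor Q N P))
        (qbAssoc Q M N P)) ∧
    -- naturality of the associativity constraint
    (∀ M M' N N' P P' : QBModData Q, IsQBMod Q M → IsQBMod Q M' → IsQBMod Q N →
      IsQBMod Q N' → IsQBMod Q P → IsQBMod Q P' →
      ∀ (f : M.X ⟶ M'.X) (g : N.X ⟶ N'.X) (h : P.X ⟶ P'.X),
        IsQBHom Q M M' f → IsQBHom Q N N' g → IsQBHom Q P P' h →
        qbAssoc Q M N P ≫ (f ▷ (N.X ≫ P.X) ≫ M'.X ◁ (g ▷ P.X ≫ N'.X ◁ h))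
          = ((f ▷ N.X ≫ M'.X ◁ g) ▷ P.X ≫ (M'.X ≫ N'.X) ◁ h) ≫
              qbAssoc Q M' N' P') ∧
    -- the pentagon identity
    (∀ M N P R : QBModData Q, IsQBMod Q M → IsQBMod Q N → IsQBMod Q P →
      IsQBMod Q R →
      qbAssoc Q (qbTensor Q M N) P R ≫ qbAssoc Q M N (qbTensor Q P R)
        = qbAssoc Q M N P ▷ R.X ≫ qbAssoc Q M (qbTensor Q N P) R ≫
            M.X ◁ qbAssoc Q N P R) ∧
    -- the triangle identity (the unit constraints being the canonical ones)
    (∀ M N : QBModData Q, IsQBMod Q M → IsQBMod Q N →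
      qbAssoc Q M (qbUnit Q) N ≫ M.X ◁ (λ_ N.X).hom = (ρ_ M.X).hom ▷ N.X) ∧
    -- the unit constraints are morphisms of Tambara modules
    (∀ M : QBModData Q, IsQBMod Q M →
      IsQBHom Q (qbTensor Q (qbUnit Q) M) M (λ_ M.X).hom ∧
      IsQBHom Q (qbTensor Q M (qbUnit Q)) M (ρ_ M.X).hom) := by
  refine ⟨fun M N hM hN => hM.tensor hN, IsQBMod.qbUnit Q,
    fun M N P hM hN hP => hM.qbAssoc_isIso hN hP,
    fun M N P hM hN hP => hM.qbAssoc_isQBHom hN hP,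
    fun M M' N N' P P' _ _ _ _ _ _ f g h hf hg hh => IsQBMod.qbAssoc_naturality hf hg hh,
    fun M N P R hM hN hP hR => hM.qbAssoc_pentagon hN hP hR,
    fun M N hM hN => hM.qbAssoc_triangle hN,
    fun M hM => ⟨IsQBMod.isQBHom_leftUnitor M, hM.isQBHom_rightUnitor⟩⟩

end Paper
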